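/- For every countable collection of languages 𝓛 : ℕ → Set ℕ (each 𝓛 i infinite), every ε ∈ (0,1), and every real M ≥ 1, there exists a function I : List ℕ → Finset ℕ such that for every index i* and every injective sequence x : ℕ → ℕ that is an M-bounded displacement enumeration with respect to K := 𝓛 i*, with {n : x_n ∈ K} infinite and R(K; x_{1:n}) → 0 as n → ∞ (an M-bounded enumeration of K with o(1)-noise and arbitrary omissions): writing C_n := ⋂_{j ∈ I(x_1,…,x_n)} 𝓛 j, the set C_n is infinite for every n, and there exists n* such that for all n ≥ n*, C_n ⊆ K and μ_low(C_n, K) ≥ (1 − ε)/M. -/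

import Mathlib

open Filter Set Topology

/-- The list `[x 0, …, x (n-1)]` of the first `n` elements of the stream `x`
(the paper's `x_1, …, x_n`). -/
def prefixList (x : ℕ → ℕ) (n : ℕ) : List ℕ := (List.range n).map x

/-- The set of the first `n` elements of the stream `x` (the paper's `{x_1, …, x_n}`). -/
def seen (x : ℕ → ℕ) (n : ℕ) : Set ℕ := x '' {t | t < n}

/-- The empirical noise rate `R(L; x_{1:n})` of the first `n` elements of `x` w.r.t. `L`. -/
noncomputable def noiseRate (L : Set ℕ) (x : ℕ → ℕ) (n : ℕ) : ℝ :=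
  (({t | t < n ∧ x t ∉ L}).ncard : ℝ) / n

/-- `|A ∩ {b_1, …, b_m}| / m` where `b_1 < b_2 < …` is the increasing enumeration of `B`. -/
noncomputable def densityRatio (A B : Set ℕ) (m : ℕ) : ℝ :=
  (({j | j < m ∧ Nat.nth (· ∈ B) j ∈ A}).ncard : ℝ) / m

/-- Lower density `μ_low(A, B)` of `A` in `B`. -/
noncomputable def lowDensity (A B : Set ℕ) : ℝ := Filter.liminf (densityRatio A B) Filter.atTop

/-- Upper density `μ_up(A, B)` of `A` in `B`. -/
noncomputable def upDensity (A B : Set ℕ) : ℝ := Filter.limsup (densityRatio A B) Filter.atTop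
open Classical in
/-- The 1-indexed position `σ(y, L)` of `y` in the increasing enumeration of `L`
(and `0` if `y ∉ L`). -/
noncomputable def position (y : ℕ) (L : Set ℕ) : ℕ :=
  if y ∈ L then {z | z ∈ L ∧ z ≤ y}.ncard else 0

/-- `x` is an `M`-bounded displacement enumeration w.r.t. `L`:
`σ(x_n, L) ≤ M · n` for all sufficiently large `n` (here `x t` is the `(t+1)`-st element). -/
def MBounded (x : ℕ → ℕ) (L : Set ℕ) (M : ℝ) : Prop :=
  ∃ nstar : ℕ, ∀ n ≥ nstar, (position (x n) L : ℝ) ≤ M * (n + 1)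

/-- The time `t` counts against `L` when the noise rate of the first `t` elements exceeds `δ`,
or when the displacement bound fails at `t`. -/
def Violates (L : Set ℕ) (δ M : ℝ) (x : ℕ → ℕ) (t : ℕ) : Prop :=
  δ < noiseRate L x t ∨ M * (t + 1) < position (x t) L

/-- The noise tolerance of the `j`-th language; the tolerances sum to `ε`. -/
noncomputable def tolerance (ε : ℝ) (j : ℕ) : ℝ := ε * ((1 / 2) * (1 / 2) ^ j)

open Classical in
/-- The cost of the `j`-th language at time `n`: its index plus its number of violations. -/
noncomputable def cost (𝓛 : ℕ → Set ℕ) (ε M : ℝ) (x : ℕ → ℕ) (n j : ℕ) : ℕ :=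
  j + ((Finset.range n).filter (Violates (𝓛 j) (tolerance ε j) M x)).card

/-- The languages of cost at most `k` at time `n`. -/
noncomputable def cheap (𝓛 : ℕ → Set ℕ) (ε M : ℝ) (x : ℕ → ℕ) (n k : ℕ) : Finset ℕ :=
  (Finset.range (k + 1)).filter fun j => cost 𝓛 ε M x n j ≤ k

/-- A finite family is admissible when its intersection is infinite and has lower density at
least `(1 - ε) / M` in each of its members. -/
def Admissible (𝓛 : ℕ → Set ℕ) (ε M : ℝ) (S : Finset ℕ) : Prop :=
  (⋂ j ∈ S, 𝓛 j).Infinite ∧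
    ∀ i ∈ S, (1 - ε) / M ≤ lowDensity (⋂ j ∈ S, 𝓛 j) (𝓛 i)

open Classical in
/-- The largest admissible family of cheap languages, over cost bounds up to the current time. -/
noncomputable def generator (𝓛 : ℕ → Set ℕ) (ε M : ℝ) (l : List ℕ) : Finset ℕ :=
  let S := cheap 𝓛 ε M (fun t => l.getD t 0) l.length
  if ∃ k ≤ l.length, Admissible 𝓛 ε M (S k) then
    S (Nat.findGreatest (fun k => Admissible 𝓛 ε M (S k)) l.length)
  else ∅

lemma noiseRate_congr {L : Set ℕ} {x y : ℕ → ℕ} {n : ℕ} (h : ∀ t < n, x t = y t) :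
    noiseRate L x n = noiseRate L y n := by
  have : {t | t < n ∧ x t ∉ L} = {t | t < n ∧ y t ∉ L} := by
    ext t
    simp only [Set.mem_ofPred_eq]
    exact and_congr_right fun ht => by rw [h t ht]
  rw [noiseRate, noiseRate, this]

lemma cost_congr {𝓛 : ℕ → Set ℕ} {ε M : ℝ} {x y : ℕ → ℕ} {n : ℕ}
    (h : ∀ t < n, x t = y t) (j : ℕ) : cost 𝓛 ε M x n j = cost 𝓛 ε M y n j := by
  classical
  unfold cost
  congr 2
  refine Finset.filter_congr fun t ht => ?_
  have ht := Finset.mem_range.1 ht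
  rw [Violates, Violates, noiseRate_congr fun s hs => h s (hs.trans ht), h t ht]

lemma mem_cheap {𝓛 : ℕ → Set ℕ} {ε M : ℝ} {x : ℕ → ℕ} {n k j : ℕ} :
    j ∈ cheap 𝓛 ε M x n k ↔ cost 𝓛 ε M x n j ≤ k := by
  simp only [cheap, Finset.mem_filter, Finset.mem_range, and_iff_right_iff_imp]
  intro h
  have : j ≤ cost 𝓛 ε M x n j := Nat.le_add_right _ _
  omega

lemma cheap_mono {𝓛 : ℕ → Set ℕ} {ε M : ℝ} {x : ℕ → ℕ} {n : ℕ} :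
    Monotone (cheap 𝓛 ε M x n) := fun _ _ h _ hj =>
  mem_cheap.2 ((mem_cheap.1 hj).trans h)

lemma generator_prefixList (𝓛 : ℕ → Set ℕ) (ε M : ℝ) (x : ℕ → ℕ) (n : ℕ) :
    (generator 𝓛 ε M (prefixList x n) = ∅ ∧
        ∀ k ≤ n, ¬ Admissible 𝓛 ε M (cheap 𝓛 ε M x n k)) ∨
      Admissible 𝓛 ε M (generator 𝓛 ε M (prefixList x n)) ∧
        ∀ k ≤ n, Admissible 𝓛 ε M (cheap 𝓛 ε M x n k) →
          cheap 𝓛 ε M x n k ⊆ generator 𝓛 ε M (prefixList x n) := by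
  classical
  have hlen : (prefixList x n).length = n := by simp [prefixList]
  have hS : cheap 𝓛 ε M (fun t => (prefixList x n).getD t 0) n = cheap 𝓛 ε M x n := by
    funext k
    ext j
    rw [mem_cheap, mem_cheap, cost_congr]
    intro t ht
    simp [prefixList, ht]
  simp only [generator, hlen, hS]
  split_ifs with h
  · obtain ⟨k, hk, hA⟩ := h
    exact Or.inr ⟨Nat.findGreatest_spec (P := fun k => Admissible 𝓛 ε M (cheap 𝓛 ε M x n k)) hk hA,
      fun k hk hA => cheap_mono (Nat.le_findGreatest hk hA)⟩
  · exact Or.inl ⟨rfl, fun k hk hA => h ⟨k, hk, hA⟩⟩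

lemma sum_tolerance_le {ε : ℝ} (hε : 0 ≤ ε) (S : Finset ℕ) : ∑ j ∈ S, tolerance ε j ≤ ε := by
  have h := (hasSum_geometric_two.mul_left (1 / 2 : ℝ)).mul_left ε
  have := sum_le_hasSum S (fun j _ => by positivity) h
  simpa [tolerance] using this

lemma densityRatio_le_one (A B : Set ℕ) (m : ℕ) : densityRatio A B m ≤ 1 := by
  refine div_le_one_of_le₀ ?_ (Nat.cast_nonneg m)
  have : {j | j < m ∧ Nat.nth (· ∈ B) j ∈ A}.ncard ≤ (Set.Iio m).ncard :=
    Set.ncard_le_ncard (fun j hj => hj.1) (Set.finite_Iio m)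
  rw [Set.ncard_Iio_nat] at this
  exact_mod_cast this

lemma le_lowDensity {A B : Set ℕ} {d c : ℝ}
    (h : ∀ᶠ m : ℕ in atTop, d - c / m ≤ densityRatio A B m) : d ≤ lowDensity A B := by
  have hlim : Tendsto (fun m : ℕ => d - c / m) atTop (𝓝 d) := by
    simpa using (tendsto_const_nhds (x := d)).sub (tendsto_const_div_atTop_nhds_zero_nat c)
  rw [← hlim.liminf_eq]
  exact liminf_le_liminf h hlim.isBoundedUnder_ge
    (IsBoundedUnder.isCoboundedUnder_ge ⟨1, by
      simpa using ⟨0, fun m _ => densityRatio_le_one A B m⟩⟩)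

open Classical in
lemma position_of_mem {y : ℕ} {L : Set ℕ} (h : y ∈ L) :
    position y L = Nat.count (· ∈ L) y + 1 := by
  have : {z | z ∈ L ∧ z ≤ y} = ((Finset.range (y + 1)).filter (· ∈ L) : Finset ℕ) := by
    ext z
    simp [and_comm]
  rw [position, if_pos h, this, Set.ncard_coe_finset, ← Nat.count_eq_card_filter_range,
    Nat.count_succ, if_pos h]

/-- If few of the first elements avoid each member of a finite family, then most of them lie in
the intersection. -/
lemma eventually_le_ncard_inter {𝓛 : ℕ → Set ℕ} {ε : ℝ} (hε : 0 ≤ ε) {x : ℕ → ℕ} {S : Finset ℕ}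
    (h : ∀ j ∈ S, ∀ᶠ n in atTop, noiseRate (𝓛 j) x n ≤ tolerance ε j) :
    ∀ᶠ n : ℕ in atTop, (1 - ε) * n ≤ ({t | t < n ∧ x t ∈ ⋂ j ∈ S, 𝓛 j}.ncard : ℝ) := by
  classical
  filter_upwards [(Filter.eventually_all_finset S).2 h, eventually_gt_atTop 0] with n hn hn0
  have hsub : (Finset.range n) ⊆ (Finset.range n).filter (fun t => x t ∈ ⋂ j ∈ S, 𝓛 j) ∪
      S.biUnion fun j => (Finset.range n).filter fun t => x t ∉ 𝓛 j := by
    intro t ht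
    by_cases hx : x t ∈ ⋂ j ∈ S, 𝓛 j
    · exact Finset.mem_union_left _ (Finset.mem_filter.2 ⟨ht, hx⟩)
    · simp only [Set.mem_iInter, not_forall] at hx
      obtain ⟨j, hj, hxj⟩ := hx
      exact Finset.mem_union_right _
        (Finset.mem_biUnion.2 ⟨j, hj, Finset.mem_filter.2 ⟨ht, hxj⟩⟩)
  have hcard := (Finset.card_le_card hsub).trans
    ((Finset.card_union_le _ _).trans (Nat.add_le_add_left Finset.card_biUnion_le _))
  rw [Finset.card_range] at hcard
  have hcard' : (n : ℝ) ≤ ((Finset.range n).filter (fun t => x t ∈ ⋂ j ∈ S, 𝓛 j)).card +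
      ∑ j ∈ S, (((Finset.range n).filter fun t => x t ∉ 𝓛 j).card : ℝ) := by
    exact_mod_cast hcard
  have hbad : ∀ j ∈ S, (((Finset.range n).filter fun t => x t ∉ 𝓛 j).card : ℝ) ≤
      tolerance ε j * n := by
    intro j hj
    have h1 := hn j hj
    have h2 : {t | t < n ∧ x t ∉ 𝓛 j} =
        ((Finset.range n).filter fun t => x t ∉ 𝓛 j : Finset ℕ) := by
      ext t; simp
    rw [noiseRate, h2, Set.ncard_coe_finset, div_le_iff₀ (by exact_mod_cast hn0)] at h1
    exact h1
  have hsum := Finset.sum_le_sum hbad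
  rw [← Finset.sum_mul] at hsum
  have htol := mul_le_mul_of_nonneg_right (sum_tolerance_le hε S) (Nat.cast_nonneg (α := ℝ) n)
  have h2 : {t | t < n ∧ x t ∈ ⋂ j ∈ S, 𝓛 j} =
      ((Finset.range n).filter (fun t => x t ∈ ⋂ j ∈ S, 𝓛 j) : Finset ℕ) := by
    ext t; simp
  rw [h2, Set.ncard_coe_finset]
  linarith

lemma infinite_of_eventually_le_ncard {C : Set ℕ} {x : ℕ → ℕ} (hx : Function.Injective x) {a : ℝ}
    (ha : 0 < a) (h : ∀ᶠ n : ℕ in atTop, a * n ≤ ({t | t < n ∧ x t ∈ C}.ncard : ℝ)) :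
    C.Infinite := by
  intro hC
  have hlim : Tendsto (fun n : ℕ => a * (n : ℝ)) atTop atTop :=
    tendsto_natCast_atTop_atTop.const_mul_atTop ha
  obtain ⟨n, hn, hn'⟩ := (h.and (hlim.eventually_gt_atTop (C.ncard : ℝ))).exists
  have : {t | t < n ∧ x t ∈ C}.ncard ≤ C.ncard :=
    Set.ncard_le_ncard_of_injOn x (fun t ht => ht.2) hx.injOn hC
  have : ({t | t < n ∧ x t ∈ C}.ncard : ℝ) ≤ C.ncard := by exact_mod_cast this
  linarith

/-- A set which contains a fraction `a` of an `M`-bounded enumeration has lower density at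
least `a / M`. -/
lemma MBounded.le_lowDensity {C K : Set ℕ} (hCK : C ⊆ K) {x : ℕ → ℕ} (hx : Function.Injective x)
    {M a : ℝ} (hM : 1 ≤ M) (ha : 0 ≤ a) (hb : MBounded x K M)
    (h : ∀ᶠ n : ℕ in atTop, a * n ≤ ({t | t < n ∧ x t ∈ C}.ncard : ℝ)) :
    a / M ≤ lowDensity C K := by
  classical
  have hM0 : 0 < M := by linarith
  obtain ⟨n₀, hn₀⟩ := hb
  have hfloor : Tendsto (fun m : ℕ => ⌊(m : ℝ) / M⌋₊) atTop atTop :=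
    tendsto_nat_floor_atTop.comp (tendsto_natCast_atTop_atTop.atTop_div_const hM0)
  refine _root_.le_lowDensity (c := a + n₀) ?_
  filter_upwards [hfloor.eventually h, eventually_gt_atTop 0] with m hm hm0
  set n := ⌊(m : ℝ) / M⌋₊ with hn
  have hnm : M * n ≤ m := by
    have := Nat.floor_le (show 0 ≤ (m : ℝ) / M by positivity)
    rw [← hn, le_div_iff₀ hM0] at this
    linarith
  have hnm' : (m : ℝ) / M < n + 1 := Nat.lt_floor_add_one _
  have hsplit : {t | t < n ∧ x t ∈ C}.ncard ≤ {t | n₀ ≤ t ∧ t < n ∧ x t ∈ C}.ncard + n₀ := by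
    have h1 : {t | t < n ∧ x t ∈ C} ⊆ {t | n₀ ≤ t ∧ t < n ∧ x t ∈ C} ∪ Set.Iio n₀ := by
      intro t ht
      rcases le_or_gt n₀ t with h' | h'
      · exact Or.inl ⟨h', ht⟩
      · exact Or.inr h'
    have hfin : ({t | n₀ ≤ t ∧ t < n ∧ x t ∈ C} ∪ Set.Iio n₀).Finite :=
      ((Set.finite_Iio n).subset fun t ht => ht.2.1).union (Set.finite_Iio n₀)
    refine (Set.ncard_le_ncard h1 hfin).trans ((Set.ncard_union_le _ _).trans ?_)
    rw [Set.ncard_Iio_nat]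
  have hinj : {t | n₀ ≤ t ∧ t < n ∧ x t ∈ C}.ncard ≤
      {j | j < m ∧ Nat.nth (· ∈ K) j ∈ C}.ncard := by
    refine Set.ncard_le_ncard_of_injOn (fun t => Nat.count (· ∈ K) (x t)) ?_ ?_
      ((Set.finite_Iio m).subset fun j hj => hj.1)
    · rintro t ⟨ht0, htn, htC⟩
      refine ⟨?_, ?_⟩
      · have h1 := hn₀ t ht0
        rw [position_of_mem (hCK htC)] at h1
        have h2 : (t : ℝ) + 1 ≤ n := by exact_mod_cast htn
        have h3 := mul_le_mul_of_nonneg_left h2 hM0.le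
        have h4 : ((Nat.count (· ∈ K) (x t) + 1 : ℕ) : ℝ) ≤ m := h1.trans (h3.trans hnm)
        exact_mod_cast h4
      · rw [Nat.nth_count (p := (· ∈ K)) (hCK htC)]
        exact htC
    · rintro s ⟨-, -, hs⟩ t ⟨-, -, ht⟩ hst
      exact hx (Nat.count_injective (p := (· ∈ K)) (hCK hs) (hCK ht) hst)
  have hcount : ({t | t < n ∧ x t ∈ C}.ncard : ℝ) ≤
      {j | j < m ∧ Nat.nth (· ∈ K) j ∈ C}.ncard + n₀ := by
    exact_mod_cast hsplit.trans (Nat.add_le_add_right hinj _)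
  have hm0' : (0 : ℝ) < m := by exact_mod_cast hm0
  rw [densityRatio, le_div_iff₀ hm0', sub_mul, div_mul_cancel₀ _ hm0'.ne']
  have h5 : a / M * m = a * (m / M) := by ring
  nlinarith [mul_le_mul_of_nonneg_left hnm'.le ha]

lemma admissible_of_finite_violations {𝓛 : ℕ → Set ℕ} {ε M : ℝ} (hε : ε ∈ Set.Ioo (0 : ℝ) 1)
    (hM : 1 ≤ M) {x : ℕ → ℕ} (hx : Function.Injective x) {S : Finset ℕ}
    (h : ∀ j ∈ S, {t | Violates (𝓛 j) (tolerance ε j) M x t}.Finite) :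
    Admissible 𝓛 ε M S := by
  have hev : ∀ j ∈ S, ∀ᶠ t in atTop, ¬ Violates (𝓛 j) (tolerance ε j) M x t := fun j hj => by
    rw [← Nat.cofinite_eq_atTop]
    exact (h j hj).eventually_cofinite_notMem
  have hcount := eventually_le_ncard_inter hε.1.le fun j hj =>
    (hev j hj).mono fun t ht => not_lt.1 fun h' => ht (Or.inl h')
  refine ⟨infinite_of_eventually_le_ncard hx (sub_pos.2 hε.2) hcount, fun i hi => ?_⟩
  obtain ⟨N, hN⟩ := eventually_atTop.1 (hev i hi)
  exact MBounded.le_lowDensity (Set.biInter_subset_of_mem (Finset.mem_coe.2 hi)) hx hM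
    (sub_pos.2 hε.2).le ⟨N, fun n hn => not_lt.1 fun h' => hN n hn (Or.inr h')⟩ hcount

lemma eventually_lt_cost {𝓛 : ℕ → Set ℕ} {ε M : ℝ} {x : ℕ → ℕ} {j : ℕ}
    (h : {t | Violates (𝓛 j) (tolerance ε j) M x t}.Infinite) (k : ℕ) :
    ∀ᶠ n in atTop, k < cost 𝓛 ε M x n j := by
  classical
  obtain ⟨T, hT, hcard⟩ := h.exists_subset_card_eq (k + 1)
  filter_upwards [eventually_gt_atTop (T.sup id)] with n hn
  have hsub : T ⊆ (Finset.range n).filter (Violates (𝓛 j) (tolerance ε j) M x) := fun t ht =>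
    Finset.mem_filter.2 ⟨Finset.mem_range.2 ((Finset.le_sup (f := id) ht).trans_lt hn), hT ht⟩
  have := Finset.card_le_card hsub
  unfold cost
  omega

lemma cost_le {𝓛 : ℕ → Set ℕ} {ε M : ℝ} {x : ℕ → ℕ} {j : ℕ}
    (h : {t | Violates (𝓛 j) (tolerance ε j) M x t}.Finite) (n : ℕ) :
    cost 𝓛 ε M x n j ≤ j + {t | Violates (𝓛 j) (tolerance ε j) M x t}.ncard := by
  classical
  unfold cost
  rw [← Set.ncard_coe_finset]
  exact Nat.add_le_add_left (Set.ncard_le_ncard (fun t ht => (Finset.mem_filter.1 ht).2) h) _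

lemma eventually_admissible_cheap {𝓛 : ℕ → Set ℕ} {ε M : ℝ} (hε : ε ∈ Set.Ioo (0 : ℝ) 1)
    (hM : 1 ≤ M) {x : ℕ → ℕ} (hx : Function.Injective x) (k : ℕ) :
    ∀ᶠ n in atTop, Admissible 𝓛 ε M (cheap 𝓛 ε M x n k) := by
  have hev : ∀ᶠ n in atTop, ∀ j ∈ Finset.range (k + 1),
      {t | Violates (𝓛 j) (tolerance ε j) M x t}.Infinite → k < cost 𝓛 ε M x n j := by
    refine (Filter.eventually_all_finset _).2 fun j _ => ?_
    by_cases hj : {t | Violates (𝓛 j) (tolerance ε j) M x t}.Infinite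
    · exact (eventually_lt_cost hj k).mono fun n hn _ => hn
    · exact Eventually.of_forall fun n h => absurd h hj
  filter_upwards [hev] with n hn
  refine admissible_of_finite_violations hε hM hx fun j hj => Set.not_infinite.1 fun hinf => ?_
  exact (hn j (Finset.mem_filter.1 hj).1 hinf).not_ge (mem_cheap.1 hj)

/-- Set-based generation with lower density `(1-ε)/M` under `M`-bounded displacement
enumerations with `o(1)`-noise and arbitrary omissions, for every countable collection. -/
theorem set_based_density_bounded_adversary
    (𝓛 : ℕ → Set ℕ) (hinf : ∀ i, (𝓛 i).Infinite)
    (ε : ℝ) (hε : ε ∈ Set.Ioo (0:ℝ) 1) (M : ℝ) (hM : 1 ≤ M) :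
    ∃ I : List ℕ → Finset ℕ, ∀ istar : ℕ, ∀ x : ℕ → ℕ,
      Function.Injective x →
      MBounded x (𝓛 istar) M →
      {n : ℕ | x n ∈ 𝓛 istar}.Infinite →
      Filter.Tendsto (noiseRate (𝓛 istar) x) Filter.atTop (nhds 0) →
      (∀ n : ℕ, (⋂ j ∈ I (prefixList x n), 𝓛 j).Infinite) ∧
      ∃ nstar : ℕ, ∀ n ≥ nstar,
        (⋂ j ∈ I (prefixList x n), 𝓛 j) ⊆ 𝓛 istar ∧
        lowDensity (⋂ j ∈ I (prefixList x n), 𝓛 j) (𝓛 istar) ≥ (1 - ε) / M := by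
  refine ⟨generator 𝓛 ε M, fun istar x hx hb _ hnoise => ⟨fun n => ?_, ?_⟩⟩
  · rcases generator_prefixList 𝓛 ε M x n with ⟨h, -⟩ | ⟨h, -⟩
    · simpa [h] using Set.infinite_univ
    · exact h.1
  have hfin : {t | Violates (𝓛 istar) (tolerance ε istar) M x t}.Finite := by
    obtain ⟨N, hN⟩ := hb
    have htol : 0 < tolerance ε istar := mul_pos hε.1 (by positivity)
    have hev : ∀ᶠ t in cofinite, ¬ Violates (𝓛 istar) (tolerance ε istar) M x t := by
      rw [Nat.cofinite_eq_atTop]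
      filter_upwards [hnoise.eventually_le_const htol, eventually_ge_atTop N] with t ht htN
      rintro (h | h)
      · exact h.not_ge ht
      · exact h.not_ge (hN t htN)
    simpa [Filter.eventually_cofinite] using hev
  set k := istar + {t | Violates (𝓛 istar) (tolerance ε istar) M x t}.ncard
  obtain ⟨N, hN⟩ := eventually_atTop.1
    ((eventually_admissible_cheap (𝓛 := 𝓛) hε hM hx k).and (eventually_ge_atTop k))
  refine ⟨N, fun n hn => ?_⟩
  obtain ⟨hA, hk⟩ := hN n hn
  rcases generator_prefixList 𝓛 ε M x n with ⟨-, h⟩ | ⟨h, hsub⟩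
  · exact absurd hA (h k hk)
  have hmem := hsub k hk hA (mem_cheap.2 (cost_le hfin n))
  exact ⟨Set.biInter_subset_of_mem (Finset.mem_coe.2 hmem), h.2 istar hmem⟩
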